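/- (𝒞 generates the topology of Ω₁') For every p ∈ Ω₁' and every ε > 0 there exist k ∈ ℕ and (a,b) ∈ I_k such that p ∈ C_{a,b} and |x − p|₁ < ε for every x ∈ C_{a,b}; in particular p ∈ C_{a,b} ∩ Ω₁' ⊆ B_ε(p) for the ℓ¹-ball B_ε(p) in Ω₁'. -/

import Mathlib

open MeasureTheory ENNReal Filter Set

noncomputable section

/-- The space `Ω₁` of ordered partitions of `[0,1]`:
nonincreasing nonnegative sequences of sum `1`. -/
def Omega1 : Set (ℕ → ℝ) :=
  {p | (∀ i, 0 ≤ p i) ∧ Antitone p ∧ ∑' i, p i = 1}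

/-- `Ω₁'`: those `p ∈ Ω₁` with `pₙ > Σ_{j>n} pⱼ` for infinitely many `n`. -/
def Omega1' : Set (ℕ → ℝ) :=
  {p | p ∈ Omega1 ∧ {n : ℕ | (∑' j : ℕ, p (n + 1 + j)) < p n}.Infinite}

/-- The index set `I_k` (with `0`-based indices: `a 0, …, a (k-1)` correspond to
`a₁, …, a_k`, so `a (k-1)` is `a_k`). -/
def ISet (k : ℕ) (a b : ℕ → ℝ) : Prop :=
  (∀ i < k, 0 < a i ∧ a i < b i ∧ b i < 1) ∧
  (∑ i ∈ Finset.range k, b i) < 1 ∧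
  1 - (∑ i ∈ Finset.range k, a i) < a (k - 1)

/-- The neighborhood `C_{a,b} = {x ∈ Ω₁ : xᵢ ∈ (aᵢ, bᵢ) for i = 1,…,k}`. -/
def Cab (k : ℕ) (a b : ℕ → ℝ) : Set (ℕ → ℝ) :=
  {x | x ∈ Omega1 ∧ ∀ i < k, x i ∈ Set.Ioo (a i) (b i)}

lemma summable_of_mem_Omega1 {p : ℕ → ℝ} (hp : p ∈ Omega1) : Summable p := by
  by_contra h
  simpa [tsum_eq_zero_of_not_summable h] using hp.2.2

lemma sum_add_tail_of_mem_Omega1 {p : ℕ → ℝ} (hp : p ∈ Omega1) (k : ℕ) :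
    ∑ i ∈ Finset.range k, p i + ∑' i, p (i + k) = 1 := by
  rw [(summable_of_mem_Omega1 hp).sum_add_tsum_nat_add k, hp.2.2]

lemma pos_of_mem_Omega1' {p : ℕ → ℝ} (hp : p ∈ Omega1') (i : ℕ) : 0 < p i := by
  obtain ⟨n, hn, hin⟩ := hp.2.exists_gt i
  have htail : 0 ≤ ∑' j : ℕ, p (n + 1 + j) := tsum_nonneg fun j => hp.1.1 _
  exact (htail.trans_lt hn).trans_le (hp.1.2.1 hin.le)

/-- The `ℓ¹` distance is at most the distance on the first `k` coordinates plus both tails. -/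
lemma tsum_abs_sub_le {x p : ℕ → ℝ} (hx : x ∈ Omega1) (hp : p ∈ Omega1) (k : ℕ) :
    ∑' i, |x i - p i| ≤
      ∑ i ∈ Finset.range k, |x i - p i| + (∑' i, x (i + k) + ∑' i, p (i + k)) := by
  have hxs := summable_of_mem_Omega1 hx
  have hps := summable_of_mem_Omega1 hp
  have hs : Summable fun i => |x i - p i| := (hxs.sub hps).abs
  have hxk := (summable_nat_add_iff k).2 hxs
  have hpk := (summable_nat_add_iff k).2 hps
  rw [← hs.sum_add_tsum_nat_add k, ← hxk.tsum_add hpk]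
  refine add_le_add_right (Summable.tsum_le_tsum (fun i => ?_)
    ((summable_nat_add_iff k).2 hs) (hxk.add hpk)) _
  rw [abs_le]
  constructor <;> linarith [hx.1 (i + k), hp.1 (i + k)]

/-- **`𝒞` generates the topology of `Ω₁'`**: for every `p ∈ Ω₁'` and `ε > 0`
there are `k ≥ 1` and `(a,b) ∈ I_k` with `p ∈ C_{a,b}` and `|x − p|₁ < ε` for
all `x ∈ C_{a,b}`; in particular `p ∈ C_{a,b} ∩ Ω₁' ⊆ B_ε(p)`. -/
theorem calC_generates_topology (p : ℕ → ℝ) (hp : p ∈ Omega1')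
    (ε : ℝ) (hε : 0 < ε) :
    ∃ k : ℕ, 1 ≤ k ∧ ∃ a b : ℕ → ℝ, ISet k a b ∧ p ∈ Cab k a b ∧
      ∀ x ∈ Cab k a b, (∑' i : ℕ, |x i - p i|) < ε := by
  obtain ⟨n, hn, hεn⟩ : ∃ n, ∑' j, p (j + (n + 1)) < p n ∧ ∑' j, p (j + (n + 1)) < ε / 4 := by
    have hev : ∀ᶠ n in atTop, ∑' j, p (j + (n + 1)) < ε / 4 :=
      ((tendsto_sum_nat_add p).comp (tendsto_add_atTop_nat 1)).eventually_lt_const (by positivity)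
    obtain ⟨N, hN⟩ := eventually_atTop.1 hev
    obtain ⟨n, hn, hNn⟩ := hp.2.exists_gt N
    refine ⟨n, ?_, hN n hNn.le⟩
    simpa only [mem_ofPred_eq, add_comm (n + 1)] using hn
  have hpos := pos_of_mem_Omega1' hp
  have hsum := sum_add_tail_of_mem_Omega1 hp.1 (n + 1)
  have hR : 0 < ∑' j, p (j + (n + 1)) :=
    ((summable_nat_add_iff (n + 1)).2 (summable_of_mem_Omega1 hp.1)).tsum_pos
      (fun j => (hpos _).le) 0 (hpos _)
  set R := ∑' j, p (j + (n + 1))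
  obtain ⟨δ, hδ, hδR, hδp⟩ : ∃ δ : ℝ, 0 < δ ∧ (n + 1) * δ < R ∧ (n + 1) * δ + δ < p n - R := by
    have hm : 0 < min R (p n - R) := lt_min hR (sub_pos.2 hn)
    have hδ : 0 < min R (p n - R) / (n + 3) := by positivity
    have hmul : (n + 3) * (min R (p n - R) / (n + 3)) = min R (p n - R) := by field_simp
    refine ⟨_, hδ, ?_, ?_⟩
    · linarith [min_le_left R (p n - R)]
    · linarith [min_le_right R (p n - R)]
  have hnδ : 0 < (n + 1) * δ := by positivity
  have hb : ∑ i ∈ Finset.range (n + 1), (p i + δ) < 1 := by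
    simp only [Finset.sum_add_distrib, Finset.sum_const, Finset.card_range, nsmul_eq_mul]
    push_cast
    linarith
  refine ⟨n + 1, by omega, fun i => p i - δ, fun i => p i + δ, ⟨fun i hi => ⟨?_, ?_, ?_⟩, hb, ?_⟩,
    ⟨hp.1, fun i _ => ⟨by linarith, by linarith⟩⟩, fun x hx => ?_⟩
  · linarith [hp.1.2.1 (Nat.lt_succ_iff.1 hi)]
  · linarith
  · exact (Finset.single_le_sum (f := fun i => p i + δ) (fun j _ => (add_pos (hpos j) hδ).le)
      (Finset.mem_range.2 hi)).trans_lt hb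
  · simp only [Finset.sum_sub_distrib, Finset.sum_const, Finset.card_range, nsmul_eq_mul,
      Nat.add_sub_cancel]
    push_cast
    linarith
  · have hle := tsum_abs_sub_le hx.1 hp.1 (n + 1)
    have hxsum := sum_add_tail_of_mem_Omega1 hx.1 (n + 1)
    have hhead : ∑ i ∈ Finset.range (n + 1), |x i - p i| ≤ (n + 1) * δ := by
      refine (Finset.sum_le_card_nsmul _ _ δ fun i hi => ?_).trans_eq (by simp)
      have h := hx.2 i (Finset.mem_range.1 hi)
      rw [abs_le]
      constructor <;> linarith [h.1, h.2]
    have hdiff : ∑ i ∈ Finset.range (n + 1), p i - ∑ i ∈ Finset.range (n + 1), x i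
        ≤ ∑ i ∈ Finset.range (n + 1), |x i - p i| := by
      rw [← Finset.sum_sub_distrib]
      exact Finset.sum_le_sum fun i _ => by linarith [neg_abs_le (x i - p i)]
    linarith

end
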